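/- For every s ≥ ξ_r := max{ξ_{1,r}, ξ_{2,r}} and every k ≥ 1: Σ_{σ∈Λ_{k,r}} h(σ)^{s/(s+r)} ≤ Σ_{h=0}^{l_{1k}−1} a(s)^{l_{1k}−h} b(s)^h + Σ_{h=l_{1k}}^{l_{2k}} b(s)^h + b(s)^{l_{1k}}. -/

import Mathlib

open MeasureTheory Filter

/-- The `n`-th quantization error of order `r` of a Borel measure `P` on `ℝ^q`:
the infimum of `(∫ d(x,α)^r dP)^{1/r}` over finite sets `α` with `1 ≤ card α ≤ n`. -/
noncomputable def quantErr {q : ℕ} (P : Measure (EuclideanSpace ℝ (Fin q)))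
    (n : ℕ) (r : ℝ) : ℝ :=
  sInf ((fun α : Finset (EuclideanSpace ℝ (Fin q)) =>
      (∫ x, Metric.infDist x (α : Set (EuclideanSpace ℝ (Fin q))) ^ r ∂P) ^ (1 / r)) ''
    {α : Finset (EuclideanSpace ℝ (Fin q)) | α.Nonempty ∧ α.card ≤ n})

/-- Product of weights `g` along a word `σ` (equals `1` for the empty word). -/
noncomputable def prodw {N : ℕ} (g : Fin N → ℝ) (σ : List (Fin N)) : ℝ := (σ.map g).prod

/-- The composition `f_{σ_1} ∘ ⋯ ∘ f_{σ_n}` along a word `σ`. -/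
def wordMap {q N : ℕ} (f : Fin N → EuclideanSpace ℝ (Fin q) → EuclideanSpace ℝ (Fin q))
    (σ : List (Fin N)) : EuclideanSpace ℝ (Fin q) → EuclideanSpace ℝ (Fin q) :=
  σ.foldr (fun i g => f i ∘ g) id

/-- `h(σ) = h^{(1)}(σ) + h^{(2)}(σ)` where
`h^{(1)}(σ) = Σ_{j=0}^{|σ|-1} p0 p_{σ|_j} t_{σ^{(l)}_{-j}} s_σ^r` and `h^{(2)}(σ) = p_σ s_σ^r`. -/
noncomputable def hfun {N : ℕ} (r p0 : ℝ) (s t p : Fin N → ℝ) (σ : List (Fin N)) : ℝ :=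
  (∑ j ∈ Finset.range σ.length, p0 * prodw p (σ.take j) * prodw t (σ.drop j)) * prodw s σ ^ r
    + prodw p σ * prodw s σ ^ r

/-- `η̲_r := min_{1 ≤ i ≤ N} min{p0 t_i + p_i, t_i} · s_i^r`. -/
noncomputable def etaLow {N : ℕ} (r p0 : ℝ) (s t p : Fin N → ℝ) : ℝ :=
  ⨅ i, min (p0 * t i + p i) (t i) * s i ^ r

/-- The finite maximal antichain `Λ_{k,r} = {σ : h(σ|_{|σ|-1}) ≥ η̲_r/k > h(σ)}`. -/
def Lam {N : ℕ} (r p0 : ℝ) (s t p : Fin N → ℝ) (k : ℕ) : Set (List (Fin N)) :=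
  {σ | σ ≠ [] ∧ etaLow r p0 s t p / k ≤ hfun r p0 s t p σ.dropLast ∧
    hfun r p0 s t p σ < etaLow r p0 s t p / k}

/-- `a(x) = Σ_i (t_i s_i^r)^{x/(x+r)}` (also used for `b` with `p` in place of `t`). -/
noncomputable def afun {N : ℕ} (r : ℝ) (s t : Fin N → ℝ) (x : ℝ) : ℝ :=
  ∑ i, (t i * s i ^ r) ^ (x / (x + r))

@[simp] lemma prodw_nil {N : ℕ} (g : Fin N → ℝ) : prodw g [] = 1 := rfl

@[simp] lemma prodw_cons {N : ℕ} (g : Fin N → ℝ) (i : Fin N) (σ : List (Fin N)) :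
    prodw g (i :: σ) = g i * prodw g σ := by
  simp [prodw]

lemma prodw_append {N : ℕ} (g : Fin N → ℝ) (σ τ : List (Fin N)) :
    prodw g (σ ++ τ) = prodw g σ * prodw g τ := by
  simp [prodw]

lemma prodw_pos {N : ℕ} {g : Fin N → ℝ} (hg : ∀ i, 0 < g i) (σ : List (Fin N)) :
    0 < prodw g σ := by
  induction σ with
  | nil => simp
  | cons i σ ih => simpa using mul_pos (hg i) ih

lemma prodw_mul_rpow_rpow {N : ℕ} {g s : Fin N → ℝ} (hg : ∀ i, 0 < g i) (hs : ∀ i, 0 < s i)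
    (r α : ℝ) (σ : List (Fin N)) :
    prodw (fun i => (g i * s i ^ r) ^ α) σ = (prodw g σ * prodw s σ ^ r) ^ α := by
  induction σ with
  | nil => simp
  | cons i σ ih =>
    have h1 := prodw_pos hg σ
    have h2 := prodw_pos hs σ
    have h3 := hg i
    have h4 := hs i
    rw [prodw_cons, prodw_cons, prodw_cons, ih, Real.mul_rpow h4.le h2.le,
      ← Real.mul_rpow (by positivity) (by positivity)]
    congr 1
    ring

/-- Product along a word of weights depending on the position as well as on the letter. -/
noncomputable def posProd {N : ℕ} : (ℕ → Fin N → ℝ) → List (Fin N) → ℝ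
  | _, [] => 1
  | g, i :: σ => g 0 i * posProd (fun m => g (m + 1)) σ

lemma posProd_const {N : ℕ} (g : Fin N → ℝ) (σ : List (Fin N)) :
    posProd (fun _ => g) σ = prodw g σ := by
  induction σ with
  | nil => rfl
  | cons i σ ih => rw [posProd, ih, prodw_cons]

lemma posProd_ite {N : ℕ} (f g : Fin N → ℝ) (j : ℕ) (σ : List (Fin N)) :
    posProd (fun m => if m < j then f else g) σ
      = prodw f (σ.take j) * prodw g (σ.drop j) := by
  induction σ generalizing j with
  | nil => simp [posProd]
  | cons i σ ih =>
    cases j with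
    | zero => simpa using posProd_const g (i :: σ)
    | succ j => simp [posProd, ih, mul_assoc]

lemma sum_eq_sum_preimage_cons {N : ℕ} (A : Finset (List (Fin N))) (hA : [] ∉ A)
    (F : List (Fin N) → ℝ) :
    ∑ σ ∈ A, F σ
      = ∑ i, ∑ σ ∈ A.preimage (List.cons i) (List.cons_injective.injOn), F (i :: σ) := by
  have hbi : A = Finset.univ.biUnion fun i : Fin N =>
      (A.preimage (List.cons i) (List.cons_injective.injOn)).image (List.cons i) := by
    ext σ
    cases σ with
    | nil => simp [hA]
    | cons i σ => simp
  conv_lhs => rw [hbi]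
  rw [Finset.sum_biUnion]
  · exact Finset.sum_congr rfl fun i _ =>
      Finset.sum_image fun _ _ _ _ h => List.cons_injective h
  · intro i _ j _ hij
    simp only [Function.onFun, Finset.disjoint_left, Finset.mem_image]
    rintro _ ⟨u, -, rfl⟩ ⟨v, -, h⟩
    exact hij (List.cons.inj h).1.symm

/-- Over a prefix-free finite set of words of length at least `n`, the sum of products of
nonnegative weights whose totals are at most `1` from position `n` on is at most the product of the
first `n` totals. -/
lemma sum_posProd_le_prod {N : ℕ} (g : ℕ → Fin N → ℝ) (hg : ∀ m i, 0 ≤ g m i) (n : ℕ)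
    (hn : ∀ m, n ≤ m → ∑ i, g m i ≤ 1) (A : Finset (List (Fin N)))
    (hA : ∀ σ ∈ A, ∀ τ ∈ A, σ <+: τ → σ = τ) (hlen : ∀ σ ∈ A, n ≤ σ.length) :
    ∑ σ ∈ A, posProd g σ ≤ ∏ m ∈ Finset.range n, ∑ i, g m i := by
  obtain ⟨L, hL⟩ : ∃ L, ∀ σ ∈ A, σ.length < L :=
    ⟨A.sup List.length + 1, fun σ h => Nat.lt_succ_of_le (Finset.le_sup (f := List.length) h)⟩
  induction L generalizing g n A with
  | zero =>
    have : A = ∅ := Finset.eq_empty_of_forall_notMem fun σ h => by simpa using hL σ h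
    subst this
    simpa using Finset.prod_nonneg fun m _ => Finset.sum_nonneg fun i _ => hg m i
  | succ L ih =>
    by_cases h0 : [] ∈ A
    · have hA' : A = {[]} := by
        ext τ
        simp only [Finset.mem_singleton]
        exact ⟨fun h => (hA [] h0 τ h List.nil_prefix).symm, fun h => h ▸ h0⟩
      have : n = 0 := by simpa using hlen [] h0
      subst this hA'
      simp [posProd]
    · rw [sum_eq_sum_preimage_cons A h0]
      have step : ∀ i, ∑ σ ∈ A.preimage (List.cons i) (List.cons_injective.injOn),
          posProd g (i :: σ) ≤ g 0 i * ∏ m ∈ Finset.range (n - 1), ∑ i, g (m + 1) i := by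
        intro i
        simp only [posProd, ← Finset.mul_sum]
        refine mul_le_mul_of_nonneg_left ?_ (hg 0 i)
        apply ih (fun m => g (m + 1)) (fun m => hg (m + 1)) (n - 1)
        · exact fun m hm => hn (m + 1) (by omega)
        · intro σ hσ τ hτ h
          rw [Finset.mem_preimage] at hσ hτ
          exact List.cons_injective (hA _ hσ _ hτ ((List.prefix_cons_inj i).2 h))
        · intro σ hσ
          have := hlen _ (Finset.mem_preimage.1 hσ)
          simp only [List.length_cons] at this
          omega
        · intro σ hσ
          have := hL _ (Finset.mem_preimage.1 hσ)
          simp only [List.length_cons] at this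
          omega
      refine (Finset.sum_le_sum fun i _ => step i).trans ?_
      rw [← Finset.sum_mul]
      cases n with
      | zero => simpa using hn 0 le_rfl
      | succ n => rw [Finset.prod_range_succ']; simp [mul_comm]

lemma rpow_sum_le_sum_rpow {ι : Type*} (S : Finset ι) (f : ι → ℝ) (hf : ∀ i, 0 ≤ f i) {α : ℝ}
    (h0 : 0 < α) (h1 : α ≤ 1) : (∑ i ∈ S, f i) ^ α ≤ ∑ i ∈ S, f i ^ α := by
  classical
  induction S using Finset.induction_on with
  | empty => simp [Real.zero_rpow h0.ne']
  | insert i S hi ih =>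
    rw [Finset.sum_insert hi, Finset.sum_insert hi]
    exact (Real.rpow_add_le_add_rpow (hf i) (Finset.sum_nonneg fun j _ => hf j) h0.le h1).trans
      (by gcongr)

lemma afun_antitoneOn {N : ℕ} {r : ℝ} (hr : 0 < r) {s t : Fin N → ℝ}
    (hs : ∀ i, s i ∈ Set.Ioo (0 : ℝ) 1) (ht : ∀ i, 0 < t i) (ht1 : ∀ i, t i ≤ 1) :
    AntitoneOn (afun r s t) (Set.Ioi 0) := by
  intro y hy x hx hyx
  rw [Set.mem_Ioi] at hx hy
  refine Finset.sum_le_sum fun i _ => ?_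
  have hsr : 0 < s i ^ r := Real.rpow_pos_of_pos (hs i).1 r
  refine Real.rpow_le_rpow_of_exponent_ge (mul_pos (ht i) hsr)
    (mul_le_one₀ (ht1 i) hsr.le (Real.rpow_le_one (hs i).1.le (hs i).2.le hr.le)) ?_
  rw [div_le_div_iff₀ (by positivity) (by positivity)]
  nlinarith

lemma hfun_pos {N : ℕ} (r : ℝ) {p0 : ℝ} {s t p : Fin N → ℝ} (hs : ∀ i, 0 < s i)
    (ht : ∀ i, 0 < t i) (hp0 : 0 < p0) (hp : ∀ i, 0 < p i) (σ : List (Fin N)) :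
    0 < hfun r p0 s t p σ := by
  have h1 := Real.rpow_pos_of_pos (prodw_pos hs σ) r
  have h2 := prodw_pos hp σ
  have h3 : 0 ≤ ∑ j ∈ Finset.range σ.length, p0 * prodw p (σ.take j) * prodw t (σ.drop j) :=
    Finset.sum_nonneg fun j _ => (mul_pos (mul_pos hp0 (prodw_pos hp _)) (prodw_pos ht _)).le
  unfold hfun
  positivity

lemma hfun_append_singleton_le {N : ℕ} {r : ℝ} (hr : 0 < r) {p0 : ℝ} {s t p : Fin N → ℝ}
    (hs : ∀ i, s i ∈ Set.Ioo (0 : ℝ) 1) (ht : ∀ i, 0 < t i) (ht1 : ∀ i, t i ≤ 1) (hp0 : 0 < p0)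
    (hp : ∀ i, 0 < p i) (hp1 : ∀ i, p0 + p i ≤ 1) (σ : List (Fin N)) (i : Fin N) :
    hfun r p0 s t p (σ ++ [i]) ≤ hfun r p0 s t p σ := by
  have hs0 : ∀ i, 0 < s i := fun i => (hs i).1
  have hsum : ∑ j ∈ Finset.range (σ ++ [i]).length,
      p0 * prodw p ((σ ++ [i]).take j) * prodw t ((σ ++ [i]).drop j)
      = (∑ j ∈ Finset.range σ.length, p0 * prodw p (σ.take j) * prodw t (σ.drop j)) * t i
        + p0 * prodw p σ * t i := by
    rw [List.length_append, List.length_singleton, Finset.sum_range_succ, Finset.sum_mul]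
    congr 1
    · refine Finset.sum_congr rfl fun j hj => ?_
      have hj : j ≤ σ.length := (Finset.mem_range.1 hj).le
      rw [List.take_append_of_le_length hj, List.drop_append_of_le_length hj, prodw_append t]
      simp [mul_assoc]
    · simp
  unfold hfun
  rw [hsum, prodw_append s, prodw_append p, Real.mul_rpow (prodw_pos hs0 _).le (prodw_pos hs0 _).le]
  simp only [prodw_cons, prodw_nil, mul_one]
  set H := ∑ j ∈ Finset.range σ.length, p0 * prodw p (σ.take j) * prodw t (σ.drop j)
  have hH : 0 ≤ H :=
    Finset.sum_nonneg fun j _ => (mul_pos (mul_pos hp0 (prodw_pos hp _)) (prodw_pos ht _)).le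
  have hP := prodw_pos hp σ
  have hS := Real.rpow_pos_of_pos (prodw_pos hs0 σ) r
  have hsr := Real.rpow_pos_of_pos (hs0 i) r
  have hsr1 := Real.rpow_le_one (hs0 i).le (hs i).2.le hr.le
  have h1 : H * t i ≤ H := mul_le_of_le_one_right hH (ht1 i)
  have h2 : prodw p σ * (p0 * t i + p i) ≤ prodw p σ :=
    mul_le_of_le_one_right hP.le (by nlinarith [ht1 i, hp1 i])
  have h3 : 0 ≤ H * t i + prodw p σ * (p0 * t i + p i) := by
    have := ht i
    have := hp i
    positivity
  calc (H * t i + p0 * prodw p σ * t i) * (prodw s σ ^ r * s i ^ r)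
        + prodw p σ * p i * (prodw s σ ^ r * s i ^ r)
      = (H * t i + prodw p σ * (p0 * t i + p i)) * prodw s σ ^ r * s i ^ r := by ring
    _ ≤ (H * t i + prodw p σ * (p0 * t i + p i)) * prodw s σ ^ r :=
      mul_le_of_le_one_right (mul_nonneg h3 hS.le) hsr1
    _ ≤ (H + prodw p σ) * prodw s σ ^ r := by gcongr
    _ = H * prodw s σ ^ r + prodw p σ * prodw s σ ^ r := by ring

lemma hfun_le_hfun_of_isPrefix {N : ℕ} {r : ℝ} (hr : 0 < r) {p0 : ℝ} {s t p : Fin N → ℝ}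
    (hs : ∀ i, s i ∈ Set.Ioo (0 : ℝ) 1) (ht : ∀ i, 0 < t i) (ht1 : ∀ i, t i ≤ 1) (hp0 : 0 < p0)
    (hp : ∀ i, 0 < p i) (hp1 : ∀ i, p0 + p i ≤ 1) {σ τ : List (Fin N)} (h : σ <+: τ) :
    hfun r p0 s t p τ ≤ hfun r p0 s t p σ := by
  obtain ⟨u, rfl⟩ := h
  induction u using List.reverseRecOn with
  | nil => simp
  | append_singleton u i ih =>
    rw [← List.append_assoc]
    exact (hfun_append_singleton_le hr hs ht ht1 hp0 hp hp1 _ i).trans ih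

lemma eq_of_prefix_of_mem_Lam {N : ℕ} {r : ℝ} (hr : 0 < r) {p0 : ℝ} {s t p : Fin N → ℝ}
    (hs : ∀ i, s i ∈ Set.Ioo (0 : ℝ) 1) (ht : ∀ i, 0 < t i) (ht1 : ∀ i, t i ≤ 1) (hp0 : 0 < p0)
    (hp : ∀ i, 0 < p i) (hp1 : ∀ i, p0 + p i ≤ 1) {k : ℕ} {σ τ : List (Fin N)}
    (hσ : σ ∈ Lam r p0 s t p k) (hτ : τ ∈ Lam r p0 s t p k) (h : σ <+: τ) : σ = τ := by
  obtain ⟨-, -, hσ⟩ := hσ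
  obtain ⟨hne, hτ, -⟩ := hτ
  rw [← List.dropLast_append_getLast hne, List.prefix_concat_iff,
    List.dropLast_append_getLast hne] at h
  refine h.resolve_right fun h => ?_
  exact (hτ.trans (hfun_le_hfun_of_isPrefix hr hs ht ht1 hp0 hp hp1 h)).not_gt hσ

lemma hfun_rpow_le {N : ℕ} {r p0 : ℝ} {s t p : Fin N → ℝ} (hs : ∀ i, 0 < s i)
    (ht : ∀ i, 0 < t i) (hp0 : 0 < p0) (hp01 : p0 ≤ 1) (hp : ∀ i, 0 < p i) {α : ℝ} (h0 : 0 < α)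
    (h1 : α ≤ 1) (σ : List (Fin N)) :
    hfun r p0 s t p σ ^ α
      ≤ (∑ j ∈ Finset.range σ.length, prodw (fun i => (p i * s i ^ r) ^ α) (σ.take j)
          * prodw (fun i => (t i * s i ^ r) ^ α) (σ.drop j))
        + prodw (fun i => (p i * s i ^ r) ^ α) σ := by
  have hS := Real.rpow_pos_of_pos (prodw_pos hs σ) r
  have hpos : ∀ j, 0 < p0 * prodw p (σ.take j) * prodw t (σ.drop j) * prodw s σ ^ r := fun j =>
    mul_pos (mul_pos (mul_pos hp0 (prodw_pos hp _)) (prodw_pos ht _)) hS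
  rw [hfun, Finset.sum_mul]
  refine (Real.rpow_add_le_add_rpow (Finset.sum_nonneg fun j _ => (hpos j).le)
    (mul_pos (prodw_pos hp σ) hS).le h0.le h1).trans ?_
  rw [prodw_mul_rpow_rpow hp hs]
  gcongr
  refine (rpow_sum_le_sum_rpow _ _ (fun j => (hpos j).le) h0 h1).trans ?_
  refine Finset.sum_le_sum fun j _ => ?_
  have e1 := prodw_pos hp (σ.take j)
  have e2 := prodw_pos ht (σ.drop j)
  have e3 := Real.rpow_pos_of_pos (prodw_pos hs (σ.take j)) r
  have e4 := Real.rpow_pos_of_pos (prodw_pos hs (σ.drop j)) r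
  rw [prodw_mul_rpow_rpow hp hs, prodw_mul_rpow_rpow ht hs,
    ← Real.mul_rpow (by positivity) (by positivity)]
  refine Real.rpow_le_rpow (hpos j).le ?_ h0.le
  have hsplit : prodw s σ = prodw s (σ.take j) * prodw s (σ.drop j) := by
    rw [← prodw_append, List.take_append_drop]
  rw [hsplit, Real.mul_rpow (prodw_pos hs _).le (prodw_pos hs _).le]
  calc _ = p0 * ((prodw p (σ.take j) * prodw s (σ.take j) ^ r)
        * (prodw t (σ.drop j) * prodw s (σ.drop j) ^ r)) := by ring
    _ ≤ _ := mul_le_of_le_one_left (by positivity) hp01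

/-- Sum over a prefix-free finite set of words of mixed products which switch from the weights `f`
to the weights `g` after a prefix. -/
lemma sum_sum_prodw_le {N : ℕ} {f g : Fin N → ℝ} (hf : ∀ i, 0 ≤ f i) (hg : ∀ i, 0 ≤ g i)
    (hf1 : ∑ i, f i ≤ 1) (hg1 : ∑ i, g i ≤ 1) (A : Finset (List (Fin N)))
    (hA : ∀ σ ∈ A, ∀ τ ∈ A, σ <+: τ → σ = τ) (l L : ℕ) (hl : ∀ σ ∈ A, l ≤ σ.length)
    (hL : ∀ σ ∈ A, σ.length ≤ L) :
    ∑ σ ∈ A, ((∑ j ∈ Finset.range σ.length, prodw f (σ.take j) * prodw g (σ.drop j)) + prodw f σ)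
      ≤ (∑ j ∈ Finset.range l, (∑ i, g i) ^ (l - j) * (∑ i, f i) ^ j)
        + (∑ j ∈ Finset.Icc l L, (∑ i, f i) ^ j) + (∑ i, f i) ^ l := by
  have hite : ∀ (j m : ℕ) (i : Fin N), 0 ≤ (if m < j then f else g) i := by
    intro j m i
    split_ifs
    exacts [hf i, hg i]
  have hsplit : ∀ σ ∈ A,
      ∑ j ∈ Finset.range σ.length, prodw f (σ.take j) * prodw g (σ.drop j)
      = (∑ j ∈ Finset.range l, posProd (fun m => if m < j then f else g) σ)
        + ∑ j ∈ Finset.Icc l L,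
          if j < σ.length then posProd (fun m => if m < j then f else g) σ else 0 := by
    intro σ hσ
    simp only [posProd_ite]
    rw [← Finset.sum_range_add_sum_Ico _ (hl σ hσ), ← Finset.sum_filter]
    congr 2
    ext j
    have := hL σ hσ
    simp only [Finset.mem_Ico, Finset.mem_filter, Finset.mem_Icc]
    omega
  rw [Finset.sum_add_distrib, Finset.sum_congr rfl hsplit, Finset.sum_add_distrib,
    Finset.sum_comm, Finset.sum_comm (s := A)]
  gcongr with j hj j hj
  · rw [Finset.mem_range] at hj
    refine (sum_posProd_le_prod _ (hite j) l (fun m hm => ?_) A hA hl).trans_eq ?_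
    · rwa [if_neg (by omega)]
    · rw [← Finset.prod_range_mul_prod_Ico _ hj.le, mul_comm]
      congr 1
      · rw [Finset.prod_congr rfl (g := fun _ => ∑ i, g i), Finset.prod_const, Nat.card_Ico]
        intro m hm
        rw [if_neg (by simp only [Finset.mem_Ico] at hm; omega)]
      · rw [Finset.prod_congr rfl (g := fun _ => ∑ i, f i), Finset.prod_const, Finset.card_range]
        intro m hm
        rw [if_pos (Finset.mem_range.1 hm)]
  · rw [← Finset.sum_filter]
    refine (sum_posProd_le_prod _ (hite j) j (fun m hm => ?_) _ ?_ ?_).trans_eq ?_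
    · rwa [if_neg (by omega)]
    · exact fun σ hσ τ hτ => hA σ (Finset.mem_filter.1 hσ).1 τ (Finset.mem_filter.1 hτ).1
    · exact fun σ hσ => (Finset.mem_filter.1 hσ).2.le
    · rw [Finset.prod_congr rfl (g := fun _ => ∑ i, f i), Finset.prod_const, Finset.card_range]
      intro m hm
      rw [if_pos (Finset.mem_range.1 hm)]
  · simpa only [posProd_const, Finset.prod_const, Finset.card_range] using
      sum_posProd_le_prod (fun _ => f) (fun _ => hf) l (fun _ _ => hf1) A hA hl

/-- Lemma (Zhu): for every `s ≥ ξ_r = max{ξ_{1,r}, ξ_{2,r}}` and every `k ≥ 1`,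
`Σ_{σ∈Λ_{k,r}} h(σ)^{s/(s+r)}
  ≤ Σ_{h=0}^{l_{1k}-1} a(s)^{l_{1k}-h} b(s)^h + Σ_{h=l_{1k}}^{l_{2k}} b(s)^h + b(s)^{l_{1k}}`. -/
theorem sum_h_pow_over_antichain_upper_bound
    (N : ℕ) (hN : 2 ≤ N) (r : ℝ) (hr : 0 < r)
    (s : Fin N → ℝ) (hs : ∀ i, s i ∈ Set.Ioo (0 : ℝ) 1)
    (t : Fin N → ℝ) (ht : ∀ i, 0 < t i) (ht1 : ∑ i, t i = 1)
    (p0 : ℝ) (p : Fin N → ℝ) (hp0 : 0 < p0) (hp : ∀ i, 0 < p i)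
    (hp1 : p0 + ∑ i, p i = 1)
    (ξ1 ξ2 : ℝ) (hξ1 : 0 < ξ1) (hξ2 : 0 < ξ2)
    (hξ1e : afun r s t ξ1 = 1) (hξ2e : afun r s p ξ2 = 1)
    :
    ∀ x : ℝ, max ξ1 ξ2 ≤ x → ∀ k : ℕ, 1 ≤ k →
      (∑ᶠ σ ∈ Lam r p0 s t p k, hfun r p0 s t p σ ^ (x / (x + r)))
        ≤ (∑ j ∈ Finset.range (sInf (List.length '' Lam r p0 s t p k)),
              afun r s t x ^ (sInf (List.length '' Lam r p0 s t p k) - j) * afun r s p x ^ j)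
          + (∑ j ∈ Finset.Icc (sInf (List.length '' Lam r p0 s t p k))
                (sSup (List.length '' Lam r p0 s t p k)), afun r s p x ^ j)
          + afun r s p x ^ sInf (List.length '' Lam r p0 s t p k) := by
  intro x hx k _
  have hs0 : ∀ i, 0 < s i := fun i => (hs i).1
  have ht1' : ∀ i, t i ≤ 1 := fun i =>
    ht1 ▸ Finset.single_le_sum (fun j _ => (ht j).le) (Finset.mem_univ i)
  have hp1' : ∀ i, p0 + p i ≤ 1 := fun i => by
    have := Finset.single_le_sum (fun j _ => (hp j).le) (Finset.mem_univ i)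
    linarith
  have hp01 : p0 ≤ 1 := by
    have := Finset.sum_nonneg fun j (_ : j ∈ Finset.univ) => (hp j).le
    linarith
  have hx1 : ξ1 ≤ x := (le_max_left _ _).trans hx
  have hx2 : ξ2 ≤ x := (le_max_right _ _).trans hx
  have hx0 : 0 < x := hξ1.trans_le hx1
  have ha : afun r s t x ≤ 1 := hξ1e ▸ afun_antitoneOn hr hs ht ht1' hξ1 hx0 hx1
  have hb : afun r s p x ≤ 1 :=
    hξ2e ▸ afun_antitoneOn hr hs hp (fun i => by linarith [hp1' i]) hξ2 hx0 hx2
  have hα0 : 0 < x / (x + r) := by positivity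
  have hα1 : x / (x + r) ≤ 1 := (div_le_one (by positivity)).2 (by linarith)
  have hT : ∀ i, 0 ≤ (t i * s i ^ r) ^ (x / (x + r)) := fun i =>
    Real.rpow_nonneg (mul_pos (ht i) (Real.rpow_pos_of_pos (hs0 i) r)).le _
  have hP : ∀ i, 0 ≤ (p i * s i ^ r) ^ (x / (x + r)) := fun i =>
    Real.rpow_nonneg (mul_pos (hp i) (Real.rpow_pos_of_pos (hs0 i) r)).le _
  by_cases hfin : (Lam r p0 s t p k).Finite
  · rw [finsum_mem_eq_finite_toFinset_sum _ hfin]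
    refine (Finset.sum_le_sum fun σ _ =>
      hfun_rpow_le hs0 ht hp0 hp01 hp hα0 hα1 σ).trans ?_
    refine sum_sum_prodw_le hP hT hb ha _ ?_ _ _ ?_ ?_
    · intro σ hσ τ hτ
      rw [Set.Finite.mem_toFinset] at hσ hτ
      exact eq_of_prefix_of_mem_Lam hr hs ht ht1' hp0 hp hp1' hσ hτ
    · intro σ hσ
      exact Nat.sInf_le (Set.mem_image_of_mem _ (hfin.mem_toFinset.1 hσ))
    · intro σ hσ
      exact le_csSup (hfin.image _).bddAbove (Set.mem_image_of_mem _ (hfin.mem_toFinset.1 hσ))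
  · have ha0 : 0 ≤ afun r s t x := Finset.sum_nonneg fun i _ => hT i
    have hb0 : 0 ≤ afun r s p x := Finset.sum_nonneg fun i _ => hP i
    rw [finsum_mem_eq_zero_of_infinite]
    · positivity
    · rwa [Set.inter_eq_left.2]
      exact fun σ _ => (Real.rpow_pos_of_pos (hfun_pos r hs0 ht hp0 hp σ) _).ne'
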